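/- Let A_N and B_N be Hermitian N×N matrices with A_N = B_N, let U be Haar-distributed unitary, H = A_N + U B_N U*, and define S_{B,N}(z) = -E[f_{B}(z)] / E[m_H(z)] where m_H(z) = N^{-1} Tr((H - z)^{-1}) and f_B(z) = N^{-1} Tr(B_N (H - z)^{-1}). Then for Im z > 0, Im S_{B,N}(z) ≥ 0, with equality if and only if A_N = B_N = c·I for some real c. -/

import Mathlib

open Matrix MeasureTheory

theorem aux_compact (N : ℕ) : CompactSpace (Matrix.unitaryGroup (Fin N) ℂ) := by
  have hK : IsCompact (Set.pi Set.univ (fun _ : Fin N => Set.pi Set.univ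
      (fun _ : Fin N => Metric.closedBall (0 : ℂ) 1))) :=
    isCompact_univ_pi fun _ => isCompact_univ_pi fun _ => isCompact_closedBall 0 1
  have hcl : IsClosed ((unitary (Matrix (Fin N) (Fin N) ℂ) : Set (Matrix (Fin N) (Fin N) ℂ))) :=
    isClosed_unitary
  have : IsCompact ((unitary (Matrix (Fin N) (Fin N) ℂ) : Set (Matrix (Fin N) (Fin N) ℂ))) := by
    refine IsCompact.of_isClosed_subset hK hcl ?_
    intro U hU i _ j _
    rw [mem_closedBall_zero_iff]
    exact entry_norm_bound_of_unitary hU i j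
  exact isCompact_iff_compactSpace.mp this

theorem aux_second (N : ℕ) : SecondCountableTopology (Matrix.unitaryGroup (Fin N) ℂ) := by
  have : SecondCountableTopology (Matrix (Fin N) (Fin N) ℂ) :=
    inferInstanceAs (SecondCountableTopology (Fin N → Fin N → ℂ))
  exact TopologicalSpace.Subtype.secondCountableTopology _

theorem aux_int {X E : Type*} [TopologicalSpace X] [CompactSpace X] [MeasurableSpace X]
    [OpensMeasurableSpace X] [SecondCountableTopology X] [NormedAddCommGroup E]
    (μ : Measure X) [IsFiniteMeasure μ] {f : X → E} (hf : Continuous f) : Integrable f μ := by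
  have h : IntegrableOn f Set.univ μ := hf.continuousOn.integrableOn_compact' isCompact_univ MeasurableSet.univ
  rwa [integrableOn_univ] at h

theorem aux_inv {G : Type*} [Group G] [TopologicalSpace G] [IsTopologicalGroup G]
    [CompactSpace G] [SecondCountableTopology G] [MeasurableSpace G] [BorelSpace G]
    (μ : Measure G) [IsProbabilityMeasure μ] [μ.IsMulLeftInvariant]
    {f : G → ℂ} (hf : Continuous f) : ∫ U, f U⁻¹ ∂μ = ∫ U, f U ∂μ := by
  have h1 : ∫ U, ∫ V, f (U⁻¹ * V) ∂μ ∂μ = ∫ V, f V ∂μ := by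
    simp [integral_mul_left_eq_self]
  have h2 : ∫ V, ∫ U, f (U⁻¹ * V) ∂μ ∂μ = ∫ U, f U⁻¹ ∂μ := by
    have : ∀ V : G, ∫ U, f (U⁻¹ * V) ∂μ = ∫ U, f U⁻¹ ∂μ := fun V => by
      rw [← integral_mul_left_eq_self (fun U => f U⁻¹) V⁻¹]
      simp
    simp [this]
  rw [← h1, ← h2]
  apply integral_integral_swap
  exact aux_int _ (by fun_prop)

section
open scoped ComplexOrder
variable {N : ℕ}

theorem aux_det {H : Matrix (Fin N) (Fin N) ℂ} (hH : H.IsHermitian) {z : ℂ} (hz : 0 < z.im) :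
    (H - z • 1).det ≠ 0 := by
  intro h0
  obtain ⟨v, hv, h⟩ := exists_mulVec_eq_zero_iff.mpr h0
  rw [sub_mulVec, smul_mulVec, one_mulVec, sub_eq_zero] at h
  have him : (star v ⬝ᵥ (H *ᵥ v)).im = 0 := hH.im_star_dotProduct_mulVec_self v
  rw [h, dotProduct_smul] at him
  have hpos : 0 < star v ⬝ᵥ v := dotProduct_star_self_pos_iff.mpr hv
  obtain ⟨hr, hi⟩ := Complex.lt_def.mp hpos
  simp only [Complex.zero_re, Complex.zero_im] at hr hi
  rw [smul_eq_mul, Complex.mul_im, ← hi] at him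
  have : 0 < z.im * (star v ⬝ᵥ v).re := mul_pos hz hr
  linarith

theorem aux_point (hN : 0 < N) {H : Matrix (Fin N) (Fin N) ℂ} (hH : H.IsHermitian) {z : ℂ}
    (hz : 0 < z.im) (a : ℂ) (t : ℂ) (ht : t = (N : ℂ)⁻¹ * trace (H - z • 1)⁻¹) :
    0 ≤ t.im / z.im - 2 * (star a * t).re + ‖a‖ ^ 2 ∧
    (t.im / z.im - 2 * (star a * t).re + ‖a‖ ^ 2 = 0 → (H - z • 1)⁻¹ = a • 1) := by
  have hd := aux_det hH hz
  set M := H - z • 1 with hM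
  have hu : IsUnit M.det := isUnit_iff_ne_zero.mpr hd
  set G := M⁻¹ with hG
  have hMG : M * G = 1 := mul_nonsing_inv _ hu
  have hGM : Gᴴ * Mᴴ = 1 := by rw [← conjTranspose_mul, hMG, conjTranspose_one]
  have hMM : Mᴴ - M = (z - star z) • (1 : Matrix (Fin N) (Fin N) ℂ) := by
    rw [hM, conjTranspose_sub, hH.eq, conjTranspose_smul, conjTranspose_one, sub_smul]; abel
  have key : G - Gᴴ = (z - star z) • (Gᴴ * G) := by
    calc G - Gᴴ = (Gᴴ * Mᴴ) * G - Gᴴ * (M * G) := by rw [hMG, hGM]; simp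
      _ = Gᴴ * (Mᴴ - M) * G := by noncomm_ring
      _ = _ := by rw [hMM]; simp
  have htr : trace G - star (trace G) = (z - star z) * trace (Gᴴ * G) := by
    rw [← trace_conjTranspose, ← trace_sub, key, trace_smul, smul_eq_mul]
  have hexp : trace ((G - a • 1)ᴴ * (G - a • 1)) =
      trace (Gᴴ * G) - a * star (trace G) - star a * trace G + star a * a * N := by
    rw [← trace_conjTranspose, conjTranspose_sub, conjTranspose_smul, conjTranspose_one]
    simp only [sub_mul, mul_sub, trace_sub, smul_mul_assoc, mul_smul_comm, one_mul, mul_one,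
      trace_smul, smul_eq_mul, trace_one, Fintype.card_fin]
    ring
  have hN' : (N : ℂ) ≠ 0 := by exact_mod_cast hN.ne'
  have hNr : (0 : ℝ) < N := by exact_mod_cast hN
  have htG : trace G = N * t := by rw [ht]; field_simp
  have hq : (trace (Gᴴ * G)).re = N * t.im / z.im := by
    have := congrArg Complex.im htr
    rw [htG] at this
    simp at this
    field_simp
    linarith
  have hre : (trace ((G - a • 1)ᴴ * (G - a • 1))).re =
      N * (t.im / z.im - 2 * (star a * t).re + ‖a‖ ^ 2) := by
    rw [hexp, htG]
    simp only [Complex.add_re, Complex.sub_re, hq]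
    rw [← Complex.normSq_eq_norm_sq, Complex.normSq_apply]
    simp
    ring
  have hps : 0 ≤ trace ((G - a • 1)ᴴ * (G - a • 1)) :=
    (posSemidef_conjTranspose_mul_self (G - a • 1)).trace_nonneg
  obtain ⟨h1, h2⟩ := Complex.le_def.mp hps
  rw [hre] at h1
  refine ⟨nonneg_of_mul_nonneg_right h1 hNr, fun h => ?_⟩
  have h0 : trace ((G - a • 1)ᴴ * (G - a • 1)) = 0 := by
    apply Complex.ext
    · rw [hre, h]; simp
    · exact h2.symm
  exact sub_eq_zero.mp (trace_conjTranspose_mul_self_eq_zero_iff.mp h0)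

end

theorem stmt_15 {N : ℕ} (hN : 0 < N)
    [MeasurableSpace (Matrix.unitaryGroup (Fin N) ℂ)]
    [BorelSpace (Matrix.unitaryGroup (Fin N) ℂ)]
    (μ : Measure (Matrix.unitaryGroup (Fin N) ℂ)) [IsProbabilityMeasure μ]
    [μ.IsMulLeftInvariant]
    (A B : Matrix (Fin N) (Fin N) ℂ) (hA : A.IsHermitian) (hB : B.IsHermitian)
    (hAB : A = B)
    (z : ℂ) (hz : 0 < z.im)
    (EmH Ef S : ℂ)
    (hEmH : EmH = ∫ U : Matrix.unitaryGroup (Fin N) ℂ,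
        (N : ℂ)⁻¹ * Matrix.trace ((A + (U : Matrix (Fin N) (Fin N) ℂ) * B *
          star (U : Matrix (Fin N) (Fin N) ℂ) - z • 1)⁻¹) ∂μ)
    (hEf : Ef = ∫ U : Matrix.unitaryGroup (Fin N) ℂ,
        (N : ℂ)⁻¹ * Matrix.trace (B *
          ((A + (U : Matrix (Fin N) (Fin N) ℂ) * B *
            star (U : Matrix (Fin N) (Fin N) ℂ) - z • 1)⁻¹)) ∂μ)
    (hS : S = -Ef / EmH) :
    0 ≤ S.im ∧ (S.im = 0 ↔ ∃ c : ℝ, A = (c : ℂ) • (1 : Matrix (Fin N) (Fin N) ℂ) ∧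
      B = (c : ℂ) • (1 : Matrix (Fin N) (Fin N) ℂ)) := by
  subst hAB
  have := aux_compact N
  have := aux_second N
  have hN' : (N : ℂ) ≠ 0 := by exact_mod_cast hN.ne'
  set G : Matrix.unitaryGroup (Fin N) ℂ → Matrix (Fin N) (Fin N) ℂ := fun U =>
    (A + (U : Matrix (Fin N) (Fin N) ℂ) * A * star (U : Matrix (Fin N) (Fin N) ℂ) - z • 1)⁻¹
    with hGdef
  have hH : ∀ U : Matrix.unitaryGroup (Fin N) ℂ,
      (A + (U : Matrix (Fin N) (Fin N) ℂ) * A *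
        star (U : Matrix (Fin N) (Fin N) ℂ)).IsHermitian := fun U =>
    hA.add (isHermitian_mul_mul_conjTranspose _ hA)
  have hdet := fun U => aux_det (hH U) hz
  have hGc : Continuous G := by
    have hc : Continuous fun U : Matrix.unitaryGroup (Fin N) ℂ =>
        (A + (U : Matrix (Fin N) (Fin N) ℂ) * A *
          star (U : Matrix (Fin N) (Fin N) ℂ) - z • 1) := by fun_prop
    simp only [hGdef, Matrix.inv_def, Ring.inverse_eq_inv']
    exact (hc.matrix_det.inv₀ hdet).smul hc.matrix_adjugate
  set t : Matrix.unitaryGroup (Fin N) ℂ → ℂ := fun U => (N : ℂ)⁻¹ * trace (G U) with htdef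
  have htc : Continuous t := continuous_const.mul hGc.matrix_trace
  set f : Matrix.unitaryGroup (Fin N) ℂ → ℂ := fun U => (N : ℂ)⁻¹ * trace (A * G U) with hfdef
  have hfc : Continuous f :=
    continuous_const.mul (continuous_const.matrix_mul hGc).matrix_trace
  have hEt : EmH = ∫ U, t U ∂μ := hEmH
  have hEf' : Ef = ∫ U, f U ∂μ := hEf
  have hpt : ∀ U, f U + f U⁻¹ = 1 + z * t U := by
    intro U
    have h1 : (A + (U : Matrix (Fin N) (Fin N) ℂ) * A * star (U : Matrix (Fin N) (Fin N) ℂ)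
        - z • 1) * G U = 1 := mul_nonsing_inv _ (isUnit_iff_ne_zero.mpr (hdet U))
    have huu : (U : Matrix (Fin N) (Fin N) ℂ) * star (U : Matrix (Fin N) (Fin N) ℂ) = 1 :=
      Unitary.mul_star_self_of_mem U.2
    have huu' : star (U : Matrix (Fin N) (Fin N) ℂ) * (U : Matrix (Fin N) (Fin N) ℂ) = 1 :=
      Unitary.star_mul_self_of_mem U.2
    have h2 : G U⁻¹ = star (U : Matrix (Fin N) (Fin N) ℂ) * G U * U := by
      apply Matrix.inv_eq_right_inv
      have e : ((U⁻¹ : Matrix.unitaryGroup (Fin N) ℂ) : Matrix (Fin N) (Fin N) ℂ) =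
        star (U : Matrix (Fin N) (Fin N) ℂ) := rfl
      rw [e, star_star]
      set u := (U : Matrix (Fin N) (Fin N) ℂ)
      have e2 : A + star u * A * u - z • 1 = star u * (A + u * A * star u - z • 1) * u := by
        have : star u * (A + u * A * star u - z • 1) * u =
            star u * A * u + (star u * u) * A * (star u * u) - z • (star u * u) := by
          simp only [mul_add, add_mul, mul_sub, sub_mul, mul_assoc, smul_mul_assoc,
            mul_smul_comm, one_mul]
        rw [this, huu', one_mul, mul_one]; abel
      rw [e2]
      calc star u * (A + u * A * star u - z • 1) * u * (star u * G U * u)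
          = star u * (A + u * A * star u - z • 1) * (u * star u) * G U * u := by
            simp only [mul_assoc]
        _ = star u * ((A + u * A * star u - z • 1) * G U) * u := by
            rw [huu]; simp only [mul_assoc, one_mul]
        _ = 1 := by rw [h1, mul_one, huu']
    have h3 : trace (A * G U⁻¹) = trace ((U : Matrix (Fin N) (Fin N) ℂ) * A *
        star (U : Matrix (Fin N) (Fin N) ℂ) * G U) := by
      rw [h2, ← mul_assoc, trace_mul_comm]
      simp only [mul_assoc]
    have h4 := congrArg trace h1
    rw [sub_mul, add_mul, trace_sub, trace_add, smul_mul_assoc, one_mul, trace_smul, trace_one,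
      smul_eq_mul, Fintype.card_fin] at h4
    simp only [hfdef, htdef]
    rw [h3]
    field_simp
    linear_combination h4
  have hsum : 2 * Ef = 1 + z * EmH := by
    have hi : ∫ U, f U⁻¹ ∂μ = Ef := by rw [hEf']; exact aux_inv μ hfc
    have h1 : ∫ U, (f U + f U⁻¹) ∂μ = Ef + Ef := by
      rw [integral_add (aux_int μ hfc) (aux_int μ (by fun_prop)), hi, hEf']
    have h2 : ∫ U, (1 + z * t U) ∂μ = 1 + z * EmH := by
      rw [integral_add (integrable_const _) ((aux_int μ htc).const_mul z),
        integral_const_mul, hEt]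
      simp
    simp only [hpt] at h1
    rw [h2] at h1
    rw [h1]; ring
  set F : Matrix.unitaryGroup (Fin N) ℂ → ℝ := fun U =>
    (t U).im / z.im - 2 * (star EmH * t U).re + ‖EmH‖ ^ 2 with hF
  have hFc : Continuous F := by fun_prop
  have hF0 : ∀ U, 0 ≤ F U := fun U => (aux_point hN (hH U) hz EmH (t U) rfl).1
  have hF1 : ∀ U, F U = 0 → G U = EmH • 1 := fun U =>
    (aux_point hN (hH U) hz EmH (t U) rfl).2
  have hti := aux_int μ htc
  have hFI : ∫ U, F U ∂μ = EmH.im / z.im - ‖EmH‖ ^ 2 := by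
    have i1 : ∫ U, (t U).im ∂μ = EmH.im := by
      rw [hEt]; exact integral_im hti
    have i2 : ∫ U, (star EmH * t U).re ∂μ = ‖EmH‖ ^ 2 := by
      have : ∫ U, (star EmH * t U).re ∂μ = (∫ U, star EmH * t U ∂μ).re :=
        integral_re (hti.const_mul _)
      rw [this, integral_const_mul, ← hEt, ← Complex.normSq_eq_norm_sq, Complex.normSq_apply]
      simp
    have c1 : Continuous fun U => (t U).im / z.im := by fun_prop
    have c2 : Continuous fun U => 2 * (star EmH * t U).re := by fun_prop
    simp only [hF]
    have i3 : Integrable (fun U => (t U).im / z.im - 2 * (star EmH * t U).re) μ :=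
      (aux_int μ c1).sub (aux_int μ c2)
    rw [integral_add i3 (integrable_const _),
      integral_sub (aux_int μ c1) (aux_int μ c2), integral_div, integral_const_mul, i1, i2]
    simp
    ring
  have hIn : 0 ≤ ∫ U, F U ∂μ := integral_nonneg hF0
  have hI0 : ∫ U, F U ∂μ = 0 → G 1 = EmH • 1 := by
    intro h
    have : μ.IsOpenPosMeasure :=
      isOpenPosMeasure_of_mulLeftInvariant_of_compact Set.univ isCompact_univ (by simp)
    have h1 := (integral_eq_zero_iff_of_nonneg hF0 (aux_int μ hFc)).mp h
    have h2 : F = 0 := (hFc.ae_eq_iff_eq μ continuous_zero).mp h1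
    exact hF1 1 (congrFun h2 1)
  have : Nonempty (Fin N) := ⟨⟨0, hN⟩⟩
  have hmul1 : (A + A - z • 1) * G 1 = 1 := by
    have := mul_nonsing_inv _ (isUnit_iff_ne_zero.mpr (hdet 1))
    simpa [hGdef] using this
  have ha : EmH ≠ 0 := by
    intro h0
    have := hI0 (by rw [hFI, h0]; simp)
    rw [h0, zero_smul] at this
    rw [this, mul_zero] at hmul1
    exact zero_ne_one hmul1
  have hnp : 0 < ‖EmH‖ ^ 2 := by positivity
  have hSim : S.im = z.im * (∫ U, F U ∂μ) / (2 * ‖EmH‖ ^ 2) := by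
    have hSe : S = -(1 / 2 : ℝ) * (z + EmH⁻¹) := by
      rw [hS]
      push_cast
      field_simp
      linear_combination -hsum
    rw [hSe, hFI, ← Complex.ofReal_neg, Complex.im_ofReal_mul, Complex.add_im, Complex.inv_im, Complex.normSq_eq_norm_sq]
    field_simp
    ring
  refine ⟨by rw [hSim]; positivity, fun h => ?_, ?_⟩
  · have hI : ∫ U, F U ∂μ = 0 := by
      rw [hSim] at h
      have : z.im ≠ 0 := hz.ne'
      rcases div_eq_zero_iff.mp h with h | h
      · exact (mul_eq_zero.mp h).resolve_left this
      · exfalso; linarith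
    have hG1 := hI0 hI
    rw [hG1, mul_smul_comm, mul_one] at hmul1
    have hAw : A = ((EmH⁻¹ + z) / 2) • (1 : Matrix (Fin N) (Fin N) ℂ) := by
      have h2 : A + A - z • 1 = EmH⁻¹ • (1 : Matrix (Fin N) (Fin N) ℂ) := by
        have h4 := congrArg (fun M => EmH⁻¹ • M) hmul1
        simpa only [smul_smul, inv_mul_cancel₀ ha, one_smul] using h4
      have h3 : A + A = (EmH⁻¹ + z) • (1 : Matrix (Fin N) (Fin N) ℂ) := by
        rw [add_smul, ← h2]; abel
      rw [div_eq_inv_mul, mul_smul, ← h3, ← two_smul ℂ A, smul_smul]; norm_num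
    have hreal := hA.apply ⟨0, hN⟩ ⟨0, hN⟩
    generalize (EmH⁻¹ + z) / 2 = w at hAw
    have hw : star w = w := by
      rw [hAw] at hreal
      simpa using hreal
    have hw' : ((w.re : ℝ) : ℂ) = w := Complex.conj_eq_iff_re.mp hw
    exact ⟨w.re, by rw [hw']; exact hAw, by rw [hw']; exact hAw⟩
  · rintro ⟨c, hc, -⟩
    have : ∀ U, f U = c * t U := by
      intro U
      simp only [hfdef, htdef]
      have : trace (A * G U) = c * trace (G U) := by
        conv_lhs => rw [hc]
        rw [smul_mul_assoc, one_mul, trace_smul, smul_eq_mul]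
      rw [this]; ring
    have hE : Ef = c * EmH := by
      rw [hEf', hEt, ← integral_const_mul]
      simp only [this]
    rw [hS, hE, ← neg_mul, mul_div_cancel_right₀ _ ha]
    simp
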